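/- Let f be a barcode with n = Multiset.card f bars and let ℓ₁ ≤ ℓ₂ ≤ … ≤ ℓₙ be the lifespans of its bars listed in nondecreasing order. Then the lifespans satisfy the recursion ℓᵢ = − μ(C(f^∧(n−i+1))) − Σ_{j=1}^{i−1} C(n−j, n−i) · ℓⱼ for every i with 1 ≤ i ≤ n, where C(n−j, n−i) denotes the binomial coefficient. In particular, the sorted lifespans of f can be computed recursively from the moments of the critical series of the exterior powers of f. -/

import Mathlib

noncomputable section

/-- A barcode: a finite multiset of bars `(α, ℓ)` with positive lifespan `ℓ`. -/
def IsBarcode (f : Multiset (ℝ × ℝ)) : Prop := ∀ b ∈ f, (0 : ℝ) < b.2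

/-- The `p`-th exterior power of a barcode: each `p`-element sub-multiset `s`
contributes the bar whose birth grade is the sum of the birth grades in `s`
and whose lifespan is the minimum of the lifespans in `s`. -/
noncomputable def extPow (f : Multiset (ℝ × ℝ)) (p : ℕ) : Multiset (ℝ × ℝ) :=
  (Multiset.powersetCard p f).map
    (fun s => ((s.map Prod.fst).sum, sInf {x : ℝ | x ∈ s.map Prod.snd}))

/-- The birth series `B(f) = Σ_{(α,ℓ)∈f} x^α`. -/
noncomputable def birthSeries (f : Multiset (ℝ × ℝ)) : ℝ →₀ ℤ :=
  (f.map (fun b => Finsupp.single b.1 (1 : ℤ))).sum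

/-- The death series `D(f) = Σ_{(α,ℓ)∈f} x^{α+ℓ}`. -/
noncomputable def deathSeries (f : Multiset (ℝ × ℝ)) : ℝ →₀ ℤ :=
  (f.map (fun b => Finsupp.single (b.1 + b.2) (1 : ℤ))).sum

/-- The critical series `C(f) = B(f) − D(f)`. -/
noncomputable def critSeries (f : Multiset (ℝ × ℝ)) : ℝ →₀ ℤ :=
  birthSeries f - deathSeries f

/-- The lifespan series `L(f) = Σ_{(α,ℓ)∈f} x^ℓ`. -/
noncomputable def lifespanSeries (f : Multiset (ℝ × ℝ)) : ℝ →₀ ℤ :=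
  (f.map (fun b => Finsupp.single b.2 (1 : ℤ))).sum

/-- The drift `Δ(f) = Σ_{(α,ℓ)∈f} α`. -/
noncomputable def drift (f : Multiset (ℝ × ℝ)) : ℝ :=
  (f.map Prod.fst).sum

/-- The moment `μ(P) = Σ_β P(β)·β`. -/
noncomputable def moment (P : ℝ →₀ ℤ) : ℝ :=
  P.sum fun β n => (n : ℝ) * β

/-- The second moment `μ₂(P) = Σ_β P(β)·β²`. -/
noncomputable def moment2 (P : ℝ →₀ ℤ) : ℝ :=
  P.sum fun β n => (n : ℝ) * β ^ 2

end

lemma moment_sub_aux (P Q : ℝ →₀ ℤ) : moment (P - Q) = moment P - moment Q := by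
  unfold moment
  exact Finsupp.sum_sub_index (by intros; push_cast; ring)

lemma moment_sum_single_aux (f : Multiset (ℝ × ℝ)) (g : ℝ × ℝ → ℝ) :
    moment ((f.map (fun b => Finsupp.single (g b) (1 : ℤ))).sum) = (f.map g).sum := by
  induction f using Multiset.induction_on with
  | empty => simp [moment]
  | cons a s ih =>
    have hadd : ∀ P Q : ℝ →₀ ℤ, moment (P + Q) = moment P + moment Q := by
      intro P Q
      unfold moment
      exact Finsupp.sum_add_index' (by simp) (by intros; push_cast; ring)
    rw [Multiset.map_cons, Multiset.sum_cons, Multiset.map_cons, Multiset.sum_cons, hadd, ih]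
    simp [moment]

lemma moment_crit_aux (f : Multiset (ℝ × ℝ)) :
    -moment (critSeries f) = (f.map Prod.snd).sum := by
  unfold critSeries birthSeries deathSeries
  rw [moment_sub_aux, moment_sum_single_aux f Prod.fst,
    moment_sum_single_aux f (fun b => b.1 + b.2), Multiset.sum_map_add]
  ring

lemma sum_min_aux (p n : ℕ) : ∀ (ℓ : ℕ → ℝ), (∀ i j : ℕ, i ≤ j → j < n → ℓ i ≤ ℓ j) →
    ((Multiset.powersetCard (p + 1) ((Multiset.range n).map ℓ)).map
      (fun s => sInf {x : ℝ | x ∈ s})).sum =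
    ∑ j ∈ Finset.range n, ((n - (j + 1)).choose p : ℝ) * ℓ j := by
  induction n with
  | zero => intro ℓ _; simp [Multiset.powersetCard_zero_right]
  | succ n ih =>
    intro ℓ hm
    have hr : (Multiset.range (n + 1)).map ℓ
        = ℓ 0 ::ₘ (Multiset.range n).map (fun k => ℓ (k + 1)) := by
      have h : Multiset.range (n + 1) = 0 ::ₘ (Multiset.range n).map Nat.succ := by
        simp only [Multiset.range, List.range_succ_eq_map, Multiset.map_coe, Multiset.cons_coe]
      rw [h, Multiset.map_cons, Multiset.map_map]
      rfl
    rw [hr, Multiset.powersetCard_cons, Multiset.map_add, Multiset.sum_add,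
      ih (fun k => ℓ (k + 1)) (fun i j hij hj => hm _ _ (by omega) (by omega)),
      Multiset.map_map, Finset.sum_range_succ']
    congr 1
    · apply Finset.sum_congr rfl
      intro j _
      rw [Nat.add_sub_add_right]
    · have hc : ∀ t ∈ Multiset.powersetCard p ((Multiset.range n).map (fun k => ℓ (k + 1))),
          ((fun s : Multiset ℝ => sInf {x : ℝ | x ∈ s}) ∘ Multiset.cons (ℓ 0)) t = ℓ 0 := by
        intro t ht
        have hle := (Multiset.mem_powersetCard.1 ht).1
        have : IsLeast {x : ℝ | x ∈ ℓ 0 ::ₘ t} (ℓ 0) := by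
          refine ⟨Multiset.mem_cons_self _ _, ?_⟩
          intro x hx
          rcases Multiset.mem_cons.1 hx with rfl | hx
          · exact le_rfl
          · obtain ⟨k, hk, rfl⟩ := Multiset.mem_map.1 (Multiset.mem_of_le hle hx)
            have := Multiset.mem_range.1 hk
            exact hm _ _ (by omega) (by omega)
        exact this.csInf_eq
      rw [Multiset.map_congr rfl hc]
      simp

/-- the recursion
`ℓᵢ = −μ(C(f^∧(n−i+1))) − Σ_{j=1}^{i−1} (n−j choose n−i) ℓⱼ` (here 0-indexed:
`ℓ (i-1)` is the `i`-th smallest lifespan). -/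
theorem lifespan_recursion
    (f : Multiset (ℝ × ℝ)) (hf : IsBarcode f)
    (n : ℕ) (hn : n = Multiset.card f)
    (ℓ : ℕ → ℝ) (hmono : ∀ i j : ℕ, i ≤ j → j < n → ℓ i ≤ ℓ j)
    (hℓ : f.map Prod.snd = (Multiset.range n).map ℓ)
    (i : ℕ) (hi1 : 1 ≤ i) (hin : i ≤ n) :
    ℓ (i - 1) =
      -moment (critSeries (extPow f (n - i + 1))) -
        ∑ j ∈ Finset.range (i - 1), ((n - (j + 1)).choose (n - i) : ℝ) * ℓ j := by
  have key : -moment (critSeries (extPow f (n - i + 1)))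
      = ∑ j ∈ Finset.range n, ((n - (j + 1)).choose (n - i) : ℝ) * ℓ j := by
    rw [moment_crit_aux, ← sum_min_aux (n - i) n ℓ hmono, ← hℓ, Multiset.powersetCard_map,
      Multiset.map_map]
    unfold extPow
    rw [Multiset.map_map]
    rfl
  rw [key]
  obtain ⟨k, rfl⟩ : ∃ k, i = k + 1 := ⟨i - 1, by omega⟩
  obtain ⟨m, rfl⟩ : ∃ m, n = (k + 1) + m := ⟨n - (k + 1), by omega⟩
  rw [Finset.sum_range_add, Finset.sum_range_succ]
  have hz : ∑ x ∈ Finset.range m,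
      ((k + 1 + m - (k + 1 + x + 1)).choose (k + 1 + m - (k + 1)) : ℝ) * ℓ (k + 1 + x) = 0 := by
    apply Finset.sum_eq_zero
    intro x hx
    have := Finset.mem_range.1 hx
    rw [Nat.choose_eq_zero_of_lt (by omega)]
    simp
  rw [hz]
  simp
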